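/- (Cardinality classification of connected components.) For every point-shift F and μ-almost every ω, every connected component C of the functional graph G^F(ω) belongs to exactly one of the following three classes. Class F/F: C is finite; in this case, with n the number of foils contained in C, C has a unique directed cycle, this cycle has length n, and F^∞(C) := ⋂_{k≥0} F_ω^k(C) equals the vertex set of this cycle. Class I/F: C is infinite and every foil contained in C is finite; in this case C contains no directed cycle, every foil contained in C has a junior foil, and F^∞(C) is the vertex set of a unique bi-infinite path, i.e. of a family (x_i)_{i∈ℤ} of points of C with F_ω(x_i) = x_{i+1} for all i ∈ ℤ. Class I/I: C is infinite and every foil contained in C is infinite; in this case C contains no directed cycle and F^∞(C) = ∅. In particular, μ-almost surely no connected component contains both a finite and an infinite foil. -/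

import Mathlib

open Function Set MeasureTheory ProbabilityTheory
open scoped ENNReal NNReal

namespace PointShift

/-- Points of the grid `ℤ^d`. -/
abbrev Pt (d : ℕ) := Fin d → ℤ

/-- Configurations: subsets of the grid `ℤ^d`, identified with `{0,1}`-valued
functions, equipped with the product σ-algebra. -/
abbrev Conf (d : ℕ) := Pt d → Bool

/-- The shift `θ_t ω = ω - t`. -/
def shift {d : ℕ} (t : Pt d) (ω : Conf d) : Conf d := fun x => ω (x + t)

/-- The support of a configuration, as a subset of `ℤ^d`. -/
def pts {d : ℕ} (ω : Conf d) : Set (Pt d) := {x | ω x = true}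

/-- `g` is a point-map: it is measurable and selects a point of every
configuration having a point at the origin. -/
def IsPointMap {d : ℕ} (g : Conf d → Pt d) : Prop :=
  Measurable g ∧ ∀ ω : Conf d, ω 0 = true → ω (g ω) = true

/-- The point-shift associated with a point-map `g`: `F_ω x = x + g (θ_x ω)`. -/
def Fps {d : ℕ} (g : Conf d → Pt d) (ω : Conf d) (x : Pt d) : Pt d :=
  x + g (shift x ω)

/-- `μ` is a stationary point process on the grid: a shift-invariant probability
measure with a point at the origin with positive probability. -/
def IsStationaryPP {d : ℕ} (μ : Measure (Conf d)) : Prop :=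
  IsProbabilityMeasure μ ∧ (∀ t : Pt d, μ.map (shift t) = μ) ∧
    0 < μ {ω : Conf d | ω 0 = true}

/-- The Palm probability of `μ`: `μ` conditioned on having a point at the origin. -/
noncomputable def Palm {d : ℕ} (μ : Measure (Conf d)) : Measure (Conf d) :=
  μ[|{ω : Conf d | ω 0 = true}]

/-- The foil of the point `x` in the configuration `ω`, for the point-shift of `g`. -/
def foilOn {d : ℕ} (g : Conf d → Pt d) (ω : Conf d) (x : Pt d) : Set (Pt d) :=
  {y | ω y = true ∧ ∃ n : ℕ, (Fps g ω)^[n] y = (Fps g ω)^[n] x}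

/-- The connected component of the point `x` in the functional graph `G^F(ω)`. -/
def compOn {d : ℕ} (g : Conf d → Pt d) (ω : Conf d) (x : Pt d) : Set (Pt d) :=
  {y | ω y = true ∧ ∃ m n : ℕ, (Fps g ω)^[m] x = (Fps g ω)^[n] y}

/-- `K` is a directed cycle of the functional graph of `f`: a finite set of
distinct points `c 0, …, c (k-1)` (with `k ≥ 1`) such that `f (c i) = c ((i+1) % k)`. -/
def IsCycle {X : Type*} (f : X → X) (K : Set X) : Prop :=
  ∃ (k : ℕ) (c : ℕ → X), 0 < k ∧
    (∀ i < k, ∀ j < k, c i = c j → i = j) ∧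
    (∀ i < k, f (c i) = c ((i + 1) % k)) ∧
    K = c '' {i | i < k}

end PointShift

namespace PointShift

section Deterministic

variable {X : Type*} {f : X → X} {W : Set X}

/-- The foil of `x` for the map `f` acting on `W`. -/
def foil (f : X → X) (W : Set X) (x : X) : Set X :=
  {y | y ∈ W ∧ ∃ n : ℕ, f^[n] y = f^[n] x}

/-- The connected component of `x` in the functional graph of `f` on `W`. -/
def comp (f : X → X) (W : Set X) (x : X) : Set X :=
  {y | y ∈ W ∧ ∃ m n : ℕ, f^[m] x = f^[n] y}

/-- The points of `W` which have ancestors in `W` of every order. -/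
def core (f : X → X) (W : Set X) : Set X :=
  {y | y ∈ W ∧ ∀ k : ℕ, ∃ z ∈ W, f^[k] z = y}

theorem iterate_eq_of_le {x y : X} {n k : ℕ} (h : f^[n] y = f^[n] x) (hk : n ≤ k) :
    f^[k] y = f^[k] x := by
  obtain ⟨j, rfl⟩ := Nat.exists_eq_add_of_le' hk
  rw [iterate_add_apply, h, ← iterate_add_apply]

theorem mem_foil_self {x : X} (hx : x ∈ W) : x ∈ foil f W x := ⟨hx, 0, rfl⟩

theorem mem_comp_self {x : X} (hx : x ∈ W) : x ∈ comp f W x := ⟨hx, 0, 0, rfl⟩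

theorem foil_eq_of_mem {x y : X} (h : y ∈ foil f W x) : foil f W y = foil f W x := by
  obtain ⟨-, n, hn⟩ := h
  ext z
  constructor
  · rintro ⟨hz, k, hk⟩
    exact ⟨hz, max n k, (iterate_eq_of_le hk (le_max_right _ _)).trans
      (iterate_eq_of_le hn (le_max_left _ _))⟩
  · rintro ⟨hz, k, hk⟩
    exact ⟨hz, max n k, (iterate_eq_of_le hk (le_max_right _ _)).trans
      (iterate_eq_of_le hn (le_max_left _ _)).symm⟩

theorem mem_foil_symm {x y : X} (hx : x ∈ W) (h : y ∈ foil f W x) : x ∈ foil f W y := by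
  rw [foil_eq_of_mem h]
  exact mem_foil_self hx

theorem comp_eq_of_mem {x y : X} (h : y ∈ comp f W x) : comp f W y = comp f W x := by
  obtain ⟨-, m, n, hmn⟩ := h
  ext z
  constructor
  · rintro ⟨hz, a, b, hab⟩
    refine ⟨hz, a + m, n + b, ?_⟩
    rw [iterate_add_apply, hmn, iterate_add_apply, ← hab, ← iterate_add_apply,
      ← iterate_add_apply, add_comm]
  · rintro ⟨hz, a, b, hab⟩
    refine ⟨hz, a + n, m + b, ?_⟩
    rw [iterate_add_apply, ← hmn, iterate_add_apply, ← hab, ← iterate_add_apply,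
      ← iterate_add_apply, add_comm]

theorem foil_subset_comp (x : X) : foil f W x ⊆ comp f W x :=
  fun _ ⟨hy, n, hn⟩ => ⟨hy, n, n, hn.symm⟩

theorem iterate_mem_comp (hW : MapsTo f W W) {x y : X} (hy : y ∈ comp f W x) (k : ℕ) :
    f^[k] y ∈ comp f W x := by
  obtain ⟨hy, m, n, h⟩ := hy
  refine ⟨hW.iterate k hy, k + m, n, ?_⟩
  rw [iterate_add_apply, h, ← iterate_add_apply, ← iterate_add_apply, add_comm]

theorem map_mem_comp (hW : MapsTo f W W) {x y : X} (hy : y ∈ comp f W x) :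
    f y ∈ comp f W x := iterate_mem_comp hW hy 1

theorem mem_comp_of_iterate {x z : X} (hz : z ∈ W) {k : ℕ} (h : f^[k] z ∈ comp f W x) :
    z ∈ comp f W x := by
  obtain ⟨-, m, n, h⟩ := h
  exact ⟨hz, m, n + k, by rw [h, iterate_add_apply]⟩

theorem iInter_image_comp (x : X) :
    ⋂ k : ℕ, f^[k] '' comp f W x = core f W ∩ comp f W x := by
  ext y
  simp only [mem_iInter]
  constructor
  · intro h
    have hy : y ∈ comp f W x := by simpa using h 0
    refine ⟨⟨hy.1, fun k => ?_⟩, hy⟩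
    obtain ⟨z, hz, rfl⟩ := h k
    exact ⟨z, hz.1, rfl⟩
  · rintro ⟨⟨-, h⟩, hy⟩ k
    obtain ⟨z, hz, rfl⟩ := h k
    exact ⟨z, mem_comp_of_iterate hz hy, rfl⟩

/-- Two points of a component are, up to foils, one an iterate of the other. -/
theorem exists_iterate_mem_foil (hW : MapsTo f W W) {x y : X} (hx : x ∈ W)
    (hy : y ∈ comp f W x) :
    ∃ m : ℕ, f^[m] y ∈ foil f W x ∨ f^[m] x ∈ foil f W y := by
  obtain ⟨hy, m, n, h⟩ := hy
  rcases le_total n m with hnm | hnm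
  · refine ⟨m - n, Or.inr ⟨hW.iterate _ hx, n, ?_⟩⟩
    rw [← iterate_add_apply, Nat.add_sub_cancel' hnm, h]
  · refine ⟨n - m, Or.inl ⟨hW.iterate _ hy, m, ?_⟩⟩
    rw [← iterate_add_apply, Nat.add_sub_cancel' hnm, h]

theorem iterate_mem_foil (hW : MapsTo f W W) {x y : X} (hy : y ∈ foil f W x) (k : ℕ) :
    f^[k] y ∈ foil f W (f^[k] x) := by
  obtain ⟨hy, n, hn⟩ := hy
  refine ⟨hW.iterate k hy, n, ?_⟩
  rw [← iterate_add_apply, ← iterate_add_apply]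
  exact iterate_eq_of_le hn (n.le_add_right k)

theorem map_foil_subset (hW : MapsTo f W W) (x : X) : f '' foil f W x ⊆ foil f W (f x) := by
  rintro _ ⟨y, hy, rfl⟩
  exact iterate_mem_foil hW hy 1

theorem mem_foil_of_map_mem {x y : X} (hy : y ∈ W) (h : f y ∈ foil f W (f x)) :
    y ∈ foil f W x := by
  obtain ⟨-, n, hn⟩ := h
  exact ⟨hy, n + 1, hn⟩

theorem mapsTo_core (hW : MapsTo f W W) : MapsTo f (core f W) (core f W) := by
  rintro y ⟨hy, h⟩
  refine ⟨hW hy, fun k => ?_⟩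
  obtain ⟨z, hz, rfl⟩ := h k
  exact ⟨f z, hW hz, by rw [← iterate_succ_apply, ← iterate_succ_apply' f]⟩

theorem exists_ancestor_bound (hW : MapsTo f W W) {B : Set X} (hB : B.Finite) (hBW : B ⊆ W)
    (hdis : ∀ y ∈ B, y ∉ core f W) : ∃ k : ℕ, ∀ y ∈ B, ∀ z ∈ W, f^[k] z ≠ y := by
  have h : ∀ y ∈ B, ∃ k : ℕ, ∀ z ∈ W, f^[k] z ≠ y := by
    intro y hy
    by_contra! hcon
    exact hdis y hy ⟨hBW hy, hcon⟩
  choose! N hN using h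
  obtain ⟨M, hM⟩ := (hB.image N).bddAbove
  refine ⟨M, fun y hy z hz hzy => ?_⟩
  refine hN y hy (f^[M - N y] z) (hW.iterate _ hz) ?_
  rwa [← iterate_add_apply, Nat.add_sub_cancel' (hM ⟨y, hy, rfl⟩)]

/-- When the fibres of `f` on `W` are finite, every point of the core has a preimage there. -/
theorem exists_preimage_mem_core (hW : MapsTo f W W)
    (hfib : ∀ y, {x | x ∈ W ∧ f x = y}.Finite) {y : X} (hy : y ∈ core f W) :
    ∃ w ∈ core f W, f w = y := by
  by_contra! hcon
  obtain ⟨k, hk⟩ := exists_ancestor_bound hW (hfib y) (fun x hx => hx.1)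
    (fun w hw hwc => hcon w hwc hw.2)
  obtain ⟨z, hz, hzy⟩ := hy.2 (k + 1)
  exact hk (f^[k] z) ⟨hW.iterate k hz, by rwa [← iterate_succ_apply' f]⟩ z hz rfl

theorem eq_of_mem_core_of_mem_foil (hW : MapsTo f W W) (hinj : InjOn f (core f W)) {u v : X}
    (hu : u ∈ core f W) (hv : v ∈ core f W) (h : u ∈ foil f W v) : u = v := by
  obtain ⟨-, n, hn⟩ := h
  exact hinj.iterate (mapsTo_core hW) n hu hv hn

theorem isCycle_range_iterate {z : X} (hz : z ∈ periodicPts f) :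
    IsCycle f (range fun i : ℕ => f^[i] z) := by
  have hpos := minimalPeriod_pos_of_mem_periodicPts hz
  refine ⟨minimalPeriod f z, fun i => f^[i] z, hpos, ?_, ?_, ?_⟩
  · intro i hi j hj h
    exact (iterate_eq_iterate_iff_of_lt_minimalPeriod hi hj).1 h
  · intro i hi
    simp only [iterate_mod_minimalPeriod_eq]
    rw [iterate_succ_apply']
  · ext y
    constructor
    · rintro ⟨i, rfl⟩
      exact ⟨i % minimalPeriod f z, Nat.mod_lt _ hpos, iterate_mod_minimalPeriod_eq⟩
    · rintro ⟨i, -, rfl⟩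
      exact ⟨i, rfl⟩

theorem IsCycle.exists_periodic {K : Set X} (h : IsCycle f K) :
    ∃ z ∈ periodicPts f, K = range fun i : ℕ => f^[i] z := by
  obtain ⟨k, c, hk, -, hc, rfl⟩ := h
  have hit : ∀ i : ℕ, f^[i] (c 0) = c (i % k) := by
    intro i
    induction i with
    | zero => simp
    | succ i ih => rw [iterate_succ_apply', ih, hc _ (Nat.mod_lt _ hk), Nat.mod_add_mod]
  refine ⟨c 0, ⟨k, hk, ?_⟩, ?_⟩
  · rw [IsPeriodicPt, IsFixedPt, hit, Nat.mod_self]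
  · ext y
    constructor
    · rintro ⟨i, hi, rfl⟩
      exact ⟨i, by simp only [hit, Nat.mod_eq_of_lt hi]⟩
    · rintro ⟨i, rfl⟩
      exact ⟨i % k, Nat.mod_lt _ hk, (hit i).symm⟩

/-- All periodic points of a component lie on the orbit of any one of them. -/
theorem range_iterate_eq_periodicPts_inter (hW : MapsTo f W W) {x z : X}
    (hz : z ∈ periodicPts f) (hzx : z ∈ comp f W x) :
    (range fun i : ℕ => f^[i] z) = periodicPts f ∩ comp f W x := by
  ext y
  constructor
  · rintro ⟨i, rfl⟩
    refine ⟨?_, iterate_mem_comp hW hzx i⟩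
    obtain ⟨n, hn, h⟩ := hz
    exact ⟨n, hn, h.apply_iterate i⟩
  · rintro ⟨⟨p, hp, hper⟩, hy⟩
    rw [← comp_eq_of_mem hzx] at hy
    obtain ⟨-, m, n, h⟩ := hy
    have h1 : f^[p * n] y = y := (hper.mul_const n : _)
    refine ⟨(p - 1) * n + m, ?_⟩
    show f^[(p - 1) * n + m] z = y
    rw [iterate_add_apply, h, ← iterate_add_apply]
    conv_rhs => rw [← h1]
    congr 2
    obtain ⟨q, rfl⟩ := Nat.exists_eq_succ_of_ne_zero hp.ne'
    simp [Nat.succ_mul]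

theorem exists_iterate_mem_periodicPts (hW : MapsTo f W W) {x y : X}
    (hfin : (comp f W x).Finite) (hy : y ∈ comp f W x) :
    ∃ n : ℕ, f^[n] y ∈ periodicPts f := by
  obtain ⟨m, -, n, -, hmn, h⟩ := infinite_univ.exists_lt_map_eq_of_mapsTo
    (f := fun n : ℕ => f^[n] y) (fun n _ => iterate_mem_comp hW hy n) hfin
  refine ⟨m, n - m, Nat.sub_pos_of_lt hmn, ?_⟩
  rw [IsPeriodicPt, IsFixedPt, ← iterate_add_apply, Nat.sub_add_cancel hmn.le]
  exact h.symm

theorem iterate_mem_periodicPts {y : X} {n k : ℕ} (h : f^[n] y ∈ periodicPts f)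
    (hk : n ≤ k) : f^[k] y ∈ periodicPts f := by
  obtain ⟨j, rfl⟩ := Nat.exists_eq_add_of_le' hk
  obtain ⟨p, hp, h⟩ := h
  rw [iterate_add_apply]
  exact ⟨p, hp, h.apply_iterate j⟩

theorem exists_periodic_iterate_eq {w : X} (hw : w ∈ periodicPts f) (k : ℕ) :
    ∃ i : ℕ, f^[k] (f^[i] w) = w := by
  obtain ⟨p, hp, h⟩ := hw
  refine ⟨(p - 1) * k, ?_⟩
  rw [← iterate_add_apply]
  have h1 : f^[p * k] w = w := (h.mul_const k : _)
  conv_rhs => rw [← h1]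
  congr 2
  obtain ⟨q, rfl⟩ := Nat.exists_eq_succ_of_ne_zero hp.ne'
  simp [Nat.succ_mul, add_comm]

theorem classification_finite (hW : MapsTo f W W) {x : X} (hx : x ∈ W)
    (hfin : (comp f W x).Finite) :
    ∃ K : Set X, (IsCycle f K ∧ K ⊆ comp f W x) ∧
      (∀ K' : Set X, IsCycle f K' → K' ⊆ comp f W x → K' = K) ∧
      K.ncard = {L : Set X | ∃ y ∈ comp f W x, L = foil f W y}.ncard ∧
      (⋂ k : ℕ, f^[k] '' comp f W x) = K := by
  have hper := fun y hy => exists_iterate_mem_periodicPts (y := y) hW hfin hy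
  obtain ⟨n, hn⟩ := hper x (mem_comp_self hx)
  have hnx := iterate_mem_comp hW (mem_comp_self (f := f) hx) n
  refine ⟨periodicPts f ∩ comp f W x, ⟨?_, inter_subset_right⟩, ?_, ?_, ?_⟩
  · rw [← range_iterate_eq_periodicPts_inter hW hn hnx]
    exact isCycle_range_iterate hn
  · intro K' hK' hK'x
    obtain ⟨z, hz, rfl⟩ := hK'.exists_periodic
    exact range_iterate_eq_periodicPts_inter hW hz (hK'x ⟨0, rfl⟩)
  · have himg : {L : Set X | ∃ y ∈ comp f W x, L = foil f W y} =
        foil f W '' (periodicPts f ∩ comp f W x) := by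
      ext L
      constructor
      · rintro ⟨y, hy, rfl⟩
        obtain ⟨k, hk⟩ := hper y hy
        obtain ⟨i, hi⟩ := exists_periodic_iterate_eq hk k
        have hmem : f^[i] (f^[k] y) ∈ comp f W x :=
          iterate_mem_comp hW (iterate_mem_comp hW hy k) i
        refine ⟨f^[i] (f^[k] y), ⟨iterate_mem_periodicPts (n := 0) hk i.zero_le, hmem⟩, ?_⟩
        exact foil_eq_of_mem ⟨hmem.1, k, hi⟩
      · rintro ⟨y, hy, rfl⟩
        exact ⟨y, hy.2, rfl⟩
    rw [himg, InjOn.ncard_image]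
    rintro u ⟨hu, hux⟩ v ⟨hv, hvx⟩ huv
    obtain ⟨-, k, hk⟩ : u ∈ foil f W v := huv ▸ mem_foil_self hux.1
    obtain ⟨p, hp, hpu⟩ := hu
    obtain ⟨q, hq, hqv⟩ := hv
    have hle : k ≤ p * q * k := Nat.le_mul_of_pos_left _ (Nat.mul_pos hp hq)
    have h := iterate_eq_of_le hk hle
    have h1 : f^[p * q * k] u = u := by rw [mul_assoc]; exact hpu.mul_const _
    have h2 : f^[p * q * k] v = v := by rw [mul_right_comm]; exact hqv.const_mul _
    rwa [h1, h2] at h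
  · apply Subset.antisymm
    · choose! N hN using hper
      obtain ⟨M, hM⟩ := (hfin.image N).bddAbove
      intro y hy
      obtain ⟨z, hz, rfl⟩ := mem_iInter.1 hy M
      exact ⟨iterate_mem_periodicPts (hN z hz) (hM ⟨z, hz, rfl⟩), iterate_mem_comp hW hz M⟩
    · rintro y ⟨hy, hyx⟩
      refine mem_iInter.2 fun k => ?_
      obtain ⟨i, hi⟩ := exists_periodic_iterate_eq hy k
      exact ⟨f^[i] y, iterate_mem_comp hW hyx i, hi⟩

/-- No finite nonempty set is the set of `R`-successors of infinitely many points. -/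
def FinitelyShared (R : X → X → Prop) : Prop :=
  ∀ B : Set X, B.Finite → B.Nonempty → {x | {z | R x z} = B}.Finite

theorem FinitelyShared.finite_of_subset {R : X → X → Prop} (h : FinitelyShared R) {A B : Set X}
    (hB : B.Finite) (hB' : B.Nonempty) (hA : ∀ x ∈ A, {z | R x z} = B) : A.Finite :=
  (h B hB hB').subset hA

theorem not_isCycle_of_infinite (hW : MapsTo f W W)
    (h : FinitelyShared fun x z => z ∈ comp f W x ∧ z ∈ periodicPts f) {x : X}
    (hinf : (comp f W x).Infinite) : ¬ ∃ K : Set X, IsCycle f K ∧ K ⊆ comp f W x := by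
  rintro ⟨K, hK, hKx⟩
  have hKfin : K.Finite := by
    obtain ⟨k, c, -, -, -, rfl⟩ := hK
    exact (finite_lt_nat k).image c
  obtain ⟨z, hz, rfl⟩ := hK.exists_periodic
  refine hinf (h.finite_of_subset hKfin (range_nonempty _) fun y hy => ?_)
  rw [range_iterate_eq_periodicPts_inter hW hz (hKx ⟨0, rfl⟩), ← comp_eq_of_mem hy]
  exact inter_comm _ _

theorem foil_map_finite_iff (hW : MapsTo f W W)
    (h₁ : FinitelyShared fun x z => ∃ y ∈ foil f W x, f y = z)
    (h₂ : FinitelyShared fun x z => z ∈ foil f W x ∧ ∃ y ∈ W, f y = z) {x : X} (hx : x ∈ W) :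
    (foil f W (f x)).Finite ↔ (foil f W x).Finite := by
  have hne : (f '' foil f W x).Nonempty := ⟨f x, x, mem_foil_self hx, rfl⟩
  constructor
  · intro hfin
    refine h₁.finite_of_subset (hfin.subset (map_foil_subset hW x)) hne fun y hy => ?_
    rw [foil_eq_of_mem hy]
    rfl
  · intro hfin
    refine h₂.finite_of_subset (hfin.image f) hne fun y hy => ?_
    rw [foil_eq_of_mem hy]
    ext z
    constructor
    · rintro ⟨hz, w, hw, rfl⟩
      exact ⟨w, mem_foil_of_map_mem hw hz, rfl⟩
    · intro hz
      refine ⟨map_foil_subset hW x hz, ?_⟩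
      obtain ⟨w, hw, rfl⟩ := hz
      exact ⟨w, hw.1, rfl⟩

theorem foil_finite_iff_of_mem_comp (hW : MapsTo f W W)
    (h₁ : FinitelyShared fun x z => ∃ y ∈ foil f W x, f y = z)
    (h₂ : FinitelyShared fun x z => z ∈ foil f W x ∧ ∃ y ∈ W, f y = z) {x y : X} (hx : x ∈ W)
    (hy : y ∈ comp f W x) : (foil f W y).Finite ↔ (foil f W x).Finite := by
  have hit : ∀ (n : ℕ) {z : X}, z ∈ W → ((foil f W (f^[n] z)).Finite ↔ (foil f W z).Finite) := by
    intro n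
    induction n with
    | zero => intro z _; rfl
    | succ n ih =>
      intro z hz
      rw [iterate_succ_apply, ih (hW hz), foil_map_finite_iff hW h₁ h₂ hz]
  obtain ⟨m, hm | hm⟩ := exists_iterate_mem_foil hW hx hy
  · rw [← foil_eq_of_mem hm, hit m hy.1]
  · rw [← foil_eq_of_mem hm, hit m hx]

theorem exists_junior (hW : MapsTo f W W)
    (h : FinitelyShared fun x z => z ∈ comp f W x ∧ ¬ ∃ y ∈ W, f y ∈ foil f W z) {x y : X}
    (hinf : (comp f W x).Infinite) (hy : y ∈ comp f W x) (hfin : (foil f W y).Finite) :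
    ∃ z ∈ W, f z ∈ foil f W y := by
  by_contra hcon
  refine hinf (h.finite_of_subset hfin ⟨y, mem_foil_self hy.1⟩ fun x' hx' => ?_)
  rw [comp_eq_of_mem hx', ← comp_eq_of_mem hy]
  ext z
  constructor
  · rintro ⟨hz, hz'⟩
    obtain ⟨m, hm | hm⟩ := exists_iterate_mem_foil hW hy.1 hz
    · rcases m with _ | m
      · exact hm
      · rw [iterate_succ_apply'] at hm
        exact (hcon ⟨_, hW.iterate m hz.1, hm⟩).elim
    · rcases m with _ | m
      · exact mem_foil_symm hz.1 hm
      · rw [iterate_succ_apply'] at hm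
        exact (hz' ⟨_, hW.iterate m hy.1, hm⟩).elim
  · intro hz
    exact ⟨foil_subset_comp y hz, by rwa [foil_eq_of_mem hz]⟩

theorem core_inter_comp_nonempty (hW : MapsTo f W W) {x : X} (hx : x ∈ W) (hfin : (foil f W x).Finite)
    (hjun : ∀ y ∈ comp f W x, ∃ z ∈ W, f z ∈ foil f W y) :
    (core f W ∩ comp f W x).Nonempty := by
  have hanc : ∀ k : ℕ, ∃ z ∈ comp f W x, f^[k] z ∈ foil f W x := by
    intro k
    induction k with
    | zero => exact ⟨x, mem_comp_self hx, mem_foil_self hx⟩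
    | succ k ih =>
      obtain ⟨z, hz, hzk⟩ := ih
      obtain ⟨w, hw, hwz⟩ := hjun z hz
      have hwc : f w ∈ comp f W x := by
        rw [← comp_eq_of_mem hz]
        exact foil_subset_comp z hwz
      refine ⟨w, mem_comp_of_iterate (k := 1) hw hwc, ?_⟩
      rw [← foil_eq_of_mem hzk, iterate_succ_apply]
      exact iterate_mem_foil hW hwz k
  by_contra hcon
  obtain ⟨k, hk⟩ := exists_ancestor_bound hW hfin (fun y hy => hy.1)
    (fun y hy hyc => hcon ⟨y, hyc, foil_subset_comp x hy⟩)
  obtain ⟨z, hz, hzk⟩ := hanc k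
  exact hk _ hzk z hz.1 rfl

theorem range_eq_core_inter_comp (hW : MapsTo f W W) (hinj : InjOn f (core f W)) {x : X}
    {q : ℤ → X} (hq : ∀ i, f (q i) = q (i + 1)) (hqx : range q ⊆ comp f W x) :
    range q = core f W ∩ comp f W x := by
  have hit : ∀ (n : ℕ) (i : ℤ), f^[n] (q i) = q (i + n) := by
    intro n
    induction n with
    | zero => simp
    | succ n ih =>
      intro i
      rw [iterate_succ_apply', ih, hq]
      push_cast
      ring_nf
  have hcore : ∀ i, q i ∈ core f W := fun i =>
    ⟨(hqx ⟨i, rfl⟩).1, fun k => ⟨q (i - k), (hqx ⟨_, rfl⟩).1, by rw [hit]; simp⟩⟩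
  apply Subset.antisymm
  · rintro _ ⟨i, rfl⟩
    exact ⟨hcore i, hqx ⟨i, rfl⟩⟩
  · rintro y ⟨hyc, hy⟩
    rw [← comp_eq_of_mem (hqx ⟨0, rfl⟩)] at hy
    obtain ⟨hyW, m, n, h⟩ := hy
    refine ⟨m - n, (eq_of_mem_core_of_mem_foil hW hinj hyc (hcore _) ⟨hyW, n, ?_⟩).symm⟩
    rw [← h, hit, hit]
    simp

theorem exists_biinfinite_path (hW : MapsTo f W W) (hinj : InjOn f (core f W))
    (hsurj : ∀ y ∈ core f W, ∃ w ∈ core f W, f w = y) {x : X}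
    (hne : (core f W ∩ comp f W x).Nonempty) :
    ∃ p : ℤ → X, (∀ i, f (p i) = p (i + 1)) ∧ range p ⊆ comp f W x := by
  have hmaps : MapsTo f (core f W ∩ comp f W x) (core f W ∩ comp f W x) :=
    fun y hy => ⟨mapsTo_core hW hy.1, map_mem_comp hW hy.2⟩
  have hbij : BijOn f (core f W ∩ comp f W x) (core f W ∩ comp f W x) := by
    refine ⟨hmaps, hinj.mono inter_subset_left, ?_⟩
    rintro y ⟨hyc, hy⟩
    obtain ⟨w, hw, rfl⟩ := hsurj y hyc
    exact ⟨w, ⟨hw, mem_comp_of_iterate (k := 1) hw.1 hy⟩, rfl⟩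
  obtain ⟨y, hy⟩ := hne
  let e : Equiv.Perm ↥(core f W ∩ comp f W x) := hbij.equiv f
  refine ⟨fun i => ((e ^ i) ⟨y, hy⟩ : _), fun i => ?_, ?_⟩
  · simp only [add_comm i 1, zpow_one_add]
    rfl
  · rintro _ ⟨i, rfl⟩
    exact ((e ^ i) ⟨y, hy⟩).2.2

theorem core_inter_comp_eq_empty (hW : MapsTo f W W) (hinj : InjOn f (core f W))
    (h : FinitelyShared fun x z => z ∈ foil f W x ∧ z ∈ core f W) {x : X}
    (hinf : ∀ y ∈ comp f W x, (foil f W y).Infinite) : core f W ∩ comp f W x = ∅ := by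
  rw [eq_empty_iff_forall_notMem]
  rintro y ⟨hyc, hy⟩
  refine hinf y hy (h.finite_of_subset (finite_singleton y) (singleton_nonempty y) fun w hw => ?_)
  rw [foil_eq_of_mem hw]
  ext z
  constructor
  · rintro ⟨hz, hzc⟩
    exact eq_of_mem_core_of_mem_foil hW hinj hzc hyc hz
  · rintro rfl
    exact ⟨mem_foil_self hy.1, hyc⟩

theorem finite_fibers (h : FinitelyShared fun x z => x ∈ W ∧ f x = z) (y : X) :
    {x | x ∈ W ∧ f x = y}.Finite := by
  refine h.finite_of_subset (finite_singleton y) (singleton_nonempty y) ?_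
  rintro x ⟨hx, rfl⟩
  ext z
  simp [hx, eq_comm]

/-- The three classes of components of a self-map `f` of `W` whose equivariant structures satisfy
the finiteness conclusions of mass transport. -/
theorem classification (hW : MapsTo f W W)
    (hsurj : ∀ y ∈ core f W, ∃ w ∈ core f W, f w = y) (hinj : InjOn f (core f W))
    (hper : FinitelyShared fun x z => z ∈ comp f W x ∧ z ∈ periodicPts f)
    (himg : FinitelyShared fun x z => ∃ y ∈ foil f W x, f y = z)
    (hinter : FinitelyShared fun x z => z ∈ foil f W x ∧ ∃ y ∈ W, f y = z)
    (hjun : FinitelyShared fun x z => z ∈ comp f W x ∧ ¬ ∃ y ∈ W, f y ∈ foil f W z)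
    (hcore : FinitelyShared fun x z => z ∈ foil f W x ∧ z ∈ core f W) {x : X} (hx : x ∈ W) :
    ((comp f W x).Finite ∧
      (∃ K : Set X, (IsCycle f K ∧ K ⊆ comp f W x) ∧
        (∀ K' : Set X, IsCycle f K' → K' ⊆ comp f W x → K' = K) ∧
        K.ncard = {L : Set X | ∃ y ∈ comp f W x, L = foil f W y}.ncard ∧
        (⋂ k : ℕ, f^[k] '' comp f W x) = K)) ∨
    ((comp f W x).Infinite ∧
      (∀ y ∈ comp f W x, (foil f W y).Finite) ∧
      (¬ ∃ K : Set X, IsCycle f K ∧ K ⊆ comp f W x) ∧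
      (∀ y ∈ comp f W x, ∃ z ∈ comp f W x, foil f W (f z) = foil f W y) ∧
      (∃ p : ℤ → X, (∀ i : ℤ, f (p i) = p (i + 1)) ∧ range p ⊆ comp f W x ∧
        (⋂ k : ℕ, f^[k] '' comp f W x) = range p ∧
        (∀ q : ℤ → X, (∀ i : ℤ, f (q i) = q (i + 1)) →
          range q ⊆ comp f W x → range q = range p))) ∨
    ((comp f W x).Infinite ∧
      (∀ y ∈ comp f W x, (foil f W y).Infinite) ∧
      (¬ ∃ K : Set X, IsCycle f K ∧ K ⊆ comp f W x) ∧
      (⋂ k : ℕ, f^[k] '' comp f W x) = ∅) := by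
  by_cases hfin : (comp f W x).Finite
  · exact Or.inl ⟨hfin, classification_finite hW hx hfin⟩
  have hcyc := not_isCycle_of_infinite hW hper hfin
  have hiff := fun y hy => foil_finite_iff_of_mem_comp (y := y) hW himg hinter hx hy
  refine Or.inr ?_
  by_cases hfoil : (foil f W x).Finite
  · have hfoils := fun y hy => (hiff y hy).2 hfoil
    have hjunior := fun y hy => exists_junior (y := y) hW hjun hfin hy (hfoils y hy)
    refine Or.inl ⟨hfin, hfoils, hcyc, fun y hy => ?_, ?_⟩
    · obtain ⟨z, hz, hzy⟩ := hjunior y hy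
      have hfz : f z ∈ comp f W x := comp_eq_of_mem hy ▸ foil_subset_comp y hzy
      exact ⟨z, mem_comp_of_iterate (k := 1) hz hfz, foil_eq_of_mem hzy⟩
    · obtain ⟨p, hp, hpx⟩ := exists_biinfinite_path hW hinj hsurj
        (core_inter_comp_nonempty hW hx hfoil hjunior)
      have hpr := range_eq_core_inter_comp hW hinj hp hpx
      refine ⟨p, hp, hpx, by rw [iInter_image_comp, hpr], fun q hq hqx => ?_⟩
      rw [range_eq_core_inter_comp hW hinj hq hqx, hpr]
  · have hfoils : ∀ y ∈ comp f W x, (foil f W y).Infinite :=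
      fun y hy h => hfoil ((hiff y hy).1 h)
    refine Or.inr ⟨hfin, hfoils, hcyc, ?_⟩
    rw [iInter_image_comp]
    exact core_inter_comp_eq_empty hW hinj hcore hfoils

end Deterministic

end PointShift
namespace PointShift

section Stochastic

variable {d : ℕ} {μ : Measure (Conf d)} {g : Conf d → Pt d}

@[simp]
theorem shift_apply (t : Pt d) (ω : Conf d) (x : Pt d) : shift t ω x = ω (x + t) := rfl

theorem shift_shift (s t : Pt d) (ω : Conf d) : shift s (shift t ω) = shift (s + t) ω := by
  ext x
  simp [add_assoc]

@[fun_prop]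
theorem measurable_shift (t : Pt d) : Measurable (shift t) :=
  measurable_pi_lambda _ fun x => measurable_pi_apply (x + t)

/-- The mass transport principle on the grid. -/
theorem lintegral_tsum_mass_transport (hinv : ∀ t : Pt d, μ.map (shift t) = μ)
    {w : Conf d → Pt d → Pt d → ℝ≥0∞} (hw : ∀ x y, Measurable fun ω => w ω x y)
    (hshift : ∀ t ω x y, w (shift t ω) x y = w ω (x + t) (y + t)) (y : Pt d) :
    ∫⁻ ω, ∑' z, w ω y z ∂μ = ∫⁻ ω, ∑' x, w ω x y ∂μ := by
  rw [lintegral_tsum fun z => (hw y z).aemeasurable,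
    lintegral_tsum fun x => (hw x y).aemeasurable, ← (Equiv.subLeft (y + y)).tsum_eq]
  refine tsum_congr fun x => ?_
  rw [← hinv (x - y), lintegral_map (hw _ _) (measurable_shift _), hinv]
  refine lintegral_congr fun ω => ?_
  rw [hshift, Equiv.subLeft_apply]
  congr 1 <;> abel

/-- A relation between grid points which depends measurably and covariantly on the
configuration. -/
structure IsCovariant (R : Conf d → Pt d → Pt d → Prop) : Prop where
  measurable : ∀ x y, Measurable fun ω => R ω x y
  shift_iff : ∀ t ω x y, R (shift t ω) x y ↔ R ω (x + t) (y + t)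

theorem IsCovariant.finitelyShared [IsProbabilityMeasure μ]
    (hinv : ∀ t : Pt d, μ.map (shift t) = μ) {R : Conf d → Pt d → Pt d → Prop}
    (hR : IsCovariant R) : ∀ᵐ ω ∂μ, FinitelyShared (R ω) := by
  classical
  let r : Conf d → Pt d → Pt d → ℝ≥0∞ := fun ω x z => if R ω x z then 1 else 0
  have hr : ∀ x z, Measurable fun ω => r ω x z := fun x z =>
    Measurable.ite (measurableSet_setOfPred.2 (hR.measurable x z)) measurable_const measurable_const
  have hrs : ∀ t ω x z, r (shift t ω) x z = r ω (x + t) (z + t) := by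
    intro t ω x z
    simp only [r, hR.shift_iff]
  let N : Conf d → Pt d → ℝ≥0∞ := fun ω x => ∑' z, r ω x z
  have hN : ∀ x, Measurable fun ω => N ω x := fun x => Measurable.tsum (hr x)
  have hNs : ∀ t ω x, N (shift t ω) x = N ω (x + t) := by
    intro t ω x
    simp only [N, hrs]
    exact (Equiv.addRight t).tsum_eq fun z => r ω (x + t) z
  have hfin : ∀ y, ∀ᵐ ω ∂μ, ∑' x, r ω x y * (N ω x)⁻¹ < ⊤ := by
    intro y
    refine ae_lt_top (Measurable.tsum fun x => (hr x y).mul (hN x).inv) ?_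
    rw [← lintegral_tsum_mass_transport hinv (w := fun ω x z => r ω x z * (N ω x)⁻¹)
      (fun x z => (hr x z).mul (hN x).inv) (fun t ω x z => by simp only [hrs, hNs])]
    refine ne_top_of_le_ne_top ENNReal.one_ne_top ?_
    calc ∫⁻ ω, ∑' z, r ω y z * (N ω y)⁻¹ ∂μ ≤ ∫⁻ _, 1 ∂μ := by
          refine lintegral_mono fun ω => ?_
          rw [ENNReal.tsum_mul_right]
          exact ENNReal.mul_inv_le_one _
      _ = 1 := by simp
  filter_upwards [ae_all_iff.2 hfin] with ω hω B hB ⟨y, hy⟩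
  have hc : (∑' z, if z ∈ B then (1 : ℝ≥0∞) else 0)⁻¹ ≠ 0 := by
    rw [ENNReal.inv_ne_zero, tsum_eq_sum (s := hB.toFinset) (by simp +contextual)]
    exact ENNReal.sum_ne_top.2 fun z _ => by split_ifs <;> simp
  refine (ENNReal.finite_const_le_of_tsum_ne_top (hω y).ne hc).subset ?_
  intro x hx
  have hx' : ∀ z, R ω x z ↔ z ∈ B := fun z => Set.ext_iff.1 hx z
  simp [r, N, hx', hy]

/-- An almost surely surjective covariant self-map of a covariant set is almost surely
injective. -/
theorem ae_injOn_of_ae_surjOn [IsProbabilityMeasure μ]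
    (hinv : ∀ t : Pt d, μ.map (shift t) = μ) {S : Conf d → Set (Pt d)}
    {f : Conf d → Pt d → Pt d} (hR : IsCovariant fun ω x y => x ∈ S ω ∧ f ω x = y)
    (hsurj : ∀ᵐ ω ∂μ, ∀ y ∈ S ω, ∃ x ∈ S ω, f ω x = y) :
    ∀ᵐ ω ∂μ, InjOn (f ω) (S ω) := by
  classical
  let r : Conf d → Pt d → Pt d → ℝ≥0∞ := fun ω x z => if x ∈ S ω ∧ f ω x = z then 1 else 0
  have hr : ∀ x z, Measurable fun ω => r ω x z := fun x z =>
    Measurable.ite (measurableSet_setOfPred.2 (hR.measurable x z)) measurable_const measurable_const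
  have hout : ∀ ω y, ∑' z, r ω y z = if y ∈ S ω then 1 else 0 := by
    intro ω y
    by_cases hy : y ∈ S ω
    · simp [r, hy]
    · simp [r, hy]
  have hle : ∀ y, ∀ᵐ ω ∂μ, ∑' z, r ω y z ≤ ∑' x, r ω x y := by
    intro y
    filter_upwards [hsurj] with ω hω
    rw [hout]
    split_ifs with hy
    · obtain ⟨x, hx, hxy⟩ := hω y hy
      refine le_trans ?_ (ENNReal.le_tsum x)
      simp [r, hx, hxy]
    · exact zero_le
  have heq : ∀ y, ∀ᵐ ω ∂μ, ∑' z, r ω y z = ∑' x, r ω x y := by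
    intro y
    refine ae_eq_of_ae_le_of_lintegral_le (hle y) ?_
      (Measurable.tsum fun x => hr x y).aemeasurable ?_
    · refine ne_top_of_le_ne_top ENNReal.one_ne_top ?_
      calc ∫⁻ ω, ∑' z, r ω y z ∂μ ≤ ∫⁻ _, 1 ∂μ := by
            refine lintegral_mono fun ω => ?_
            rw [hout]
            split_ifs <;> simp
        _ = 1 := by simp
    · refine (lintegral_tsum_mass_transport hinv hr (fun t ω x z => ?_) y).ge
      simp only [r, hR.shift_iff]
  filter_upwards [ae_all_iff.2 heq] with ω hω u hu v hv huv
  by_contra hne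
  have h1 : ∑' x, r ω x (f ω u) ≤ 1 := by
    rw [← hω, hout]
    split_ifs <;> simp
  have h2 := (ENNReal.sum_le_tsum (f := fun x => r ω x (f ω u)) {u, v}).trans h1
  rw [Finset.sum_pair hne] at h2
  simp only [r, hu, hv, huv, and_self, if_true, one_add_one_eq_two] at h2
  exact ENNReal.one_lt_two.not_ge h2

theorem semiconj_Fps_shift (g : Conf d → Pt d) (t : Pt d) (ω : Conf d) :
    Semiconj (· + t) (Fps g (shift t ω)) (Fps g ω) := by
  intro x
  simp only [Fps, shift_shift]
  abel

theorem iterate_Fps_shift (g : Conf d → Pt d) (t : Pt d) (ω : Conf d) (n : ℕ) (x : Pt d) :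
    (Fps g (shift t ω))^[n] x + t = (Fps g ω)^[n] (x + t) :=
  (semiconj_Fps_shift g t ω).iterate_right n x

theorem iterate_Fps_shift_eq_iff (g : Conf d → Pt d) (t : Pt d) (ω : Conf d) (m n : ℕ)
    (x y : Pt d) :
    (Fps g (shift t ω))^[m] x = (Fps g (shift t ω))^[n] y ↔
      (Fps g ω)^[m] (x + t) = (Fps g ω)^[n] (y + t) := by
  rw [← iterate_Fps_shift, ← iterate_Fps_shift, add_left_inj]

theorem mem_pts_shift_iff (t : Pt d) (ω : Conf d) (x : Pt d) :
    x ∈ pts (shift t ω) ↔ x + t ∈ pts ω := Iff.rfl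

theorem mem_foil_shift_iff (g : Conf d → Pt d) (t : Pt d) (ω : Conf d) (x y : Pt d) :
    y ∈ foil (Fps g (shift t ω)) (pts (shift t ω)) x ↔
      y + t ∈ foil (Fps g ω) (pts ω) (x + t) := by
  simp only [foil, mem_ofPred_eq, mem_pts_shift_iff, iterate_Fps_shift_eq_iff]

theorem mem_comp_shift_iff (g : Conf d → Pt d) (t : Pt d) (ω : Conf d) (x y : Pt d) :
    y ∈ comp (Fps g (shift t ω)) (pts (shift t ω)) x ↔
      y + t ∈ comp (Fps g ω) (pts ω) (x + t) := by
  simp only [comp, mem_ofPred_eq, mem_pts_shift_iff, iterate_Fps_shift_eq_iff]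

theorem exists_add_right_iff (t : Pt d) (p : Pt d → Prop) : (∃ x, p (x + t)) ↔ ∃ x, p x :=
  (Equiv.addRight t).exists_congr_left.trans (by simp)

theorem mem_core_shift_iff (g : Conf d → Pt d) (t : Pt d) (ω : Conf d) (y : Pt d) :
    y ∈ core (Fps g (shift t ω)) (pts (shift t ω)) ↔ y + t ∈ core (Fps g ω) (pts ω) := by
  have h : ∀ (k : ℕ) (z : Pt d), (Fps g (shift t ω))^[k] z = y ↔
      (Fps g ω)^[k] (z + t) = y + t := fun k z => iterate_Fps_shift_eq_iff g t ω k 0 z y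
  simp only [core, mem_ofPred_eq, mem_pts_shift_iff, h]
  refine and_congr_right fun _ => forall_congr' fun k => ?_
  exact exists_add_right_iff t fun z => z ∈ pts ω ∧ (Fps g ω)^[k] z = y + t

theorem mem_periodicPts_shift_iff (g : Conf d → Pt d) (t : Pt d) (ω : Conf d) (y : Pt d) :
    y ∈ periodicPts (Fps g (shift t ω)) ↔ y + t ∈ periodicPts (Fps g ω) := by
  have h : ∀ n : ℕ, IsPeriodicPt (Fps g (shift t ω)) n y ↔ IsPeriodicPt (Fps g ω) n (y + t) :=
    fun n => iterate_Fps_shift_eq_iff g t ω n 0 y y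
  simp only [periodicPts, mem_ofPred_eq, h]

theorem Fps_shift_eq_iff (g : Conf d → Pt d) (t : Pt d) (ω : Conf d) (x y : Pt d) :
    Fps g (shift t ω) x = y ↔ Fps g ω (x + t) = y + t :=
  iterate_Fps_shift_eq_iff g t ω 1 0 x y

theorem measurable_Fps_iterate (hg : Measurable g) (n : ℕ) (x : Pt d) :
    Measurable fun ω => (Fps g ω)^[n] x := by
  induction n with
  | zero => exact measurable_const
  | succ n ih =>
    simp only [iterate_succ_apply']
    have h : Measurable fun p : Conf d × Pt d => Fps g p.1 p.2 :=
      measurable_from_prod_countable_left fun y =>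
        measurable_const.add (hg.comp (measurable_shift y))
    exact h.comp (measurable_id.prodMk ih)

theorem measurable_iterate_eq (hg : Measurable g) (m n : ℕ) (x y : Pt d) :
    Measurable fun ω => (Fps g ω)^[m] x = (Fps g ω)^[n] y :=
  measurableSet_setOfPred.1
    (measurableSet_eq_fun (measurable_Fps_iterate hg m x) (measurable_Fps_iterate hg n y))

theorem measurable_mem_pts (x : Pt d) : Measurable fun ω : Conf d => x ∈ pts ω :=
  measurableSet_setOfPred.1 (measurableSet_eq_fun (measurable_pi_apply x) measurable_const)

theorem measurable_mem_foil (hg : Measurable g) (x y : Pt d) :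
    Measurable fun ω => y ∈ foil (Fps g ω) (pts ω) x :=
  (measurable_mem_pts y).and (Measurable.exists fun n => measurable_iterate_eq hg n n y x)

theorem measurable_mem_comp (hg : Measurable g) (x y : Pt d) :
    Measurable fun ω => y ∈ comp (Fps g ω) (pts ω) x :=
  (measurable_mem_pts y).and
    (Measurable.exists fun m => Measurable.exists fun n => measurable_iterate_eq hg m n x y)

theorem measurable_mem_core (hg : Measurable g) (y : Pt d) :
    Measurable fun ω => y ∈ core (Fps g ω) (pts ω) :=
  (measurable_mem_pts y).and (Measurable.forall fun k => Measurable.exists fun z =>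
    (measurable_mem_pts z).and (measurable_iterate_eq hg k 0 z y))

theorem measurable_mem_periodicPts (hg : Measurable g) (y : Pt d) :
    Measurable fun ω => y ∈ periodicPts (Fps g ω) :=
  Measurable.exists fun n => measurable_const.and (measurable_iterate_eq hg n 0 y y)

theorem measurable_mem_foil_map (hg : Measurable g) (x y : Pt d) :
    Measurable fun ω => Fps g ω y ∈ foil (Fps g ω) (pts ω) x := by
  have h : ∀ ω, Fps g ω y ∈ foil (Fps g ω) (pts ω) x ↔
      ∃ z, Fps g ω y = z ∧ z ∈ foil (Fps g ω) (pts ω) x := by simp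
  simp only [h]
  exact Measurable.exists fun z =>
    (measurable_iterate_eq hg 1 0 y z).and (measurable_mem_foil hg x z)

theorem isCovariant_periodic (hg : Measurable g) :
    IsCovariant fun ω x z => z ∈ comp (Fps g ω) (pts ω) x ∧ z ∈ periodicPts (Fps g ω) where
  measurable x z := (measurable_mem_comp hg x z).and (measurable_mem_periodicPts hg z)
  shift_iff t ω x z := by rw [mem_comp_shift_iff, mem_periodicPts_shift_iff]

theorem isCovariant_image_foil (hg : Measurable g) :
    IsCovariant fun ω x z => ∃ y ∈ foil (Fps g ω) (pts ω) x, Fps g ω y = z where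
  measurable x z := Measurable.exists fun y =>
    (measurable_mem_foil hg x y).and (measurable_iterate_eq hg 1 0 y z)
  shift_iff t ω x z := by
    simp only [mem_foil_shift_iff, Fps_shift_eq_iff]
    exact exists_add_right_iff t
      fun y => y ∈ foil (Fps g ω) (pts ω) (x + t) ∧ Fps g ω y = z + t

theorem isCovariant_foil_inter_image (hg : Measurable g) :
    IsCovariant fun ω x z =>
      z ∈ foil (Fps g ω) (pts ω) x ∧ ∃ y ∈ pts ω, Fps g ω y = z where
  measurable x z := (measurable_mem_foil hg x z).and (Measurable.exists fun y =>
    (measurable_mem_pts y).and (measurable_iterate_eq hg 1 0 y z))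
  shift_iff t ω x z := by
    simp only [mem_foil_shift_iff, Fps_shift_eq_iff, mem_pts_shift_iff]
    exact and_congr_right fun _ =>
      exists_add_right_iff t fun y => y ∈ pts ω ∧ Fps g ω y = z + t

theorem isCovariant_no_junior (hg : Measurable g) :
    IsCovariant fun ω x z => z ∈ comp (Fps g ω) (pts ω) x ∧
      ¬ ∃ y ∈ pts ω, Fps g ω y ∈ foil (Fps g ω) (pts ω) z where
  measurable x z := (measurable_mem_comp hg x z).and (Measurable.exists fun y =>
    (measurable_mem_pts y).and (measurable_mem_foil_map hg z y)).not
  shift_iff t ω x z := by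
    have h : ∀ y, Fps g (shift t ω) y + t = Fps g ω (y + t) := iterate_Fps_shift g t ω 1
    simp only [mem_comp_shift_iff, mem_foil_shift_iff, mem_pts_shift_iff, h]
    exact and_congr_right fun _ => not_congr (exists_add_right_iff t
      fun y => y ∈ pts ω ∧ Fps g ω y ∈ foil (Fps g ω) (pts ω) (z + t))

theorem isCovariant_Fps_on (hg : Measurable g) {S : Conf d → Set (Pt d)}
    (hS : ∀ x, Measurable fun ω => x ∈ S ω)
    (hSs : ∀ t ω x, x ∈ S (shift t ω) ↔ x + t ∈ S ω) :
    IsCovariant fun ω x z => x ∈ S ω ∧ Fps g ω x = z where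
  measurable x z := (hS x).and (measurable_iterate_eq hg 1 0 x z)
  shift_iff t ω x z := by rw [hSs, Fps_shift_eq_iff]

theorem isCovariant_foil_inter_core (hg : Measurable g) :
    IsCovariant fun ω x z =>
      z ∈ foil (Fps g ω) (pts ω) x ∧ z ∈ core (Fps g ω) (pts ω) where
  measurable x z := (measurable_mem_foil hg x z).and (measurable_mem_core hg z)
  shift_iff t ω x z := by rw [mem_foil_shift_iff, mem_core_shift_iff]

theorem mapsTo_Fps (hg : IsPointMap g) (ω : Conf d) : MapsTo (Fps g ω) (pts ω) (pts ω) := by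
  intro x hx
  have h := hg.2 (shift x ω) (by simpa [pts] using hx)
  rwa [shift_apply, add_comm] at h

end Stochastic

end PointShift

/-- Cardinality classification of connected components. For every
point-shift `F` and `μ`-almost every `ω`, every connected component `C` of `G^F(ω)`
belongs to exactly one of the classes F/F (finite component: unique cycle, whose length
is the number of foils of `C` and whose vertex set is `F^∞(C)`), I/F (infinite component
with finite foils: acyclic, every foil has a junior foil, and `F^∞(C)` is the vertex set
of a unique bi-infinite path), or I/I (infinite component with infinite foils: acyclic
and `F^∞(C) = ∅`). -/
theorem stmt_12 {d : ℕ} (hd : 0 < d)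
    (μ : Measure (PointShift.Conf d)) [IsProbabilityMeasure μ]
    (hinv : ∀ t : PointShift.Pt d, μ.map (PointShift.shift t) = μ)
    (hpos : 0 < μ {ω : PointShift.Conf d | ω 0 = true})
    (g : PointShift.Conf d → PointShift.Pt d) (hg : PointShift.IsPointMap g) :
    ∀ᵐ ω ∂μ, ∀ x : PointShift.Pt d, ω x = true →
      -- Class F/F
      ((PointShift.compOn g ω x).Finite ∧
        (∃ K : Set (PointShift.Pt d),
          (PointShift.IsCycle (PointShift.Fps g ω) K ∧ K ⊆ PointShift.compOn g ω x) ∧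
          (∀ K' : Set (PointShift.Pt d), PointShift.IsCycle (PointShift.Fps g ω) K' →
            K' ⊆ PointShift.compOn g ω x → K' = K) ∧
          K.ncard = {L : Set (PointShift.Pt d) |
            ∃ y ∈ PointShift.compOn g ω x, L = PointShift.foilOn g ω y}.ncard ∧
          (⋂ k : ℕ, (PointShift.Fps g ω)^[k] '' PointShift.compOn g ω x) = K)) ∨
      -- Class I/F
      ((PointShift.compOn g ω x).Infinite ∧
        (∀ y ∈ PointShift.compOn g ω x, (PointShift.foilOn g ω y).Finite) ∧
        (¬ ∃ K : Set (PointShift.Pt d), PointShift.IsCycle (PointShift.Fps g ω) K ∧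
          K ⊆ PointShift.compOn g ω x) ∧
        (∀ y ∈ PointShift.compOn g ω x, ∃ z ∈ PointShift.compOn g ω x,
          PointShift.foilOn g ω (PointShift.Fps g ω z) = PointShift.foilOn g ω y) ∧
        (∃ p : ℤ → PointShift.Pt d,
          (∀ i : ℤ, PointShift.Fps g ω (p i) = p (i + 1)) ∧
          Set.range p ⊆ PointShift.compOn g ω x ∧
          (⋂ k : ℕ, (PointShift.Fps g ω)^[k] '' PointShift.compOn g ω x) = Set.range p ∧
          (∀ q : ℤ → PointShift.Pt d, (∀ i : ℤ, PointShift.Fps g ω (q i) = q (i + 1)) →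
            Set.range q ⊆ PointShift.compOn g ω x → Set.range q = Set.range p))) ∨
      -- Class I/I
      ((PointShift.compOn g ω x).Infinite ∧
        (∀ y ∈ PointShift.compOn g ω x, (PointShift.foilOn g ω y).Infinite) ∧
        (¬ ∃ K : Set (PointShift.Pt d), PointShift.IsCycle (PointShift.Fps g ω) K ∧
          K ⊆ PointShift.compOn g ω x) ∧
        (⋂ k : ℕ, (PointShift.Fps g ω)^[k] '' PointShift.compOn g ω x) = ∅) := by
  have hW := PointShift.mapsTo_Fps hg
  have hfib : ∀ᵐ ω ∂μ, PointShift.FinitelyShared fun x z =>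
      x ∈ PointShift.pts ω ∧ PointShift.Fps g ω x = z :=
    (PointShift.isCovariant_Fps_on hg.1 PointShift.measurable_mem_pts
      PointShift.mem_pts_shift_iff).finitelyShared hinv
  have hsurj : ∀ᵐ ω ∂μ, ∀ y ∈ PointShift.core (PointShift.Fps g ω) (PointShift.pts ω),
      ∃ x ∈ PointShift.core (PointShift.Fps g ω) (PointShift.pts ω),
        PointShift.Fps g ω x = y := by
    filter_upwards [hfib] with ω hω y hy
    exact PointShift.exists_preimage_mem_core (hW ω) (PointShift.finite_fibers hω) hy
  have hinj := PointShift.ae_injOn_of_ae_surjOn hinv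
    (PointShift.isCovariant_Fps_on hg.1 (PointShift.measurable_mem_core hg.1)
      (PointShift.mem_core_shift_iff g)) hsurj
  filter_upwards [hsurj, hinj, (PointShift.isCovariant_periodic hg.1).finitelyShared hinv,
    (PointShift.isCovariant_image_foil hg.1).finitelyShared hinv,
    (PointShift.isCovariant_foil_inter_image hg.1).finitelyShared hinv,
    (PointShift.isCovariant_no_junior hg.1).finitelyShared hinv,
    (PointShift.isCovariant_foil_inter_core hg.1).finitelyShared hinv]
    with ω hsurj hinj hper himg hinter hjun hcore x hx
  exact PointShift.classification (hW ω) hsurj hinj hper himg hinter hjun hcore hx
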